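/- Let H, K be Hopf algebras, P an algebra that is a K-H-bicomodule algebra (left K-comodule algebra and right H-comodule algebra with commuting coactions), and γ a convolution-invertible 2-cocycle on K. If B = P^{coH} ⊆ P is a right H-Galois extension, then _γB ⊆ _γP is again a right H-Galois extension, where _γP carries the deformed product p ·_γ q = γ(p₍₋₁₎, q₍₋₁₎) p₍₀₎q₍₀₎ and the original H-coaction. -/

import Mathlib

/-!
STATEMENT 10: Let `H, K` be Hopf algebras, `P` a `K`-`H`-bicomodule algebra,
and `γ` a convolution-invertible 2-cocycle on `K`.  If `B = P^{coH} ⊆ P` is a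
right `H`-Galois extension, then `_γB ⊆ _γP` is again a right `H`-Galois
extension, where `_γP` carries the deformed product
`p ·_γ q = γ(p₍₋₁₎, q₍₋₁₎) p₍₀₎ q₍₀₎` and the original `H`-coaction.

`P ⊗_B P` (resp. `_γP ⊗_{_γB} _γP`) is realised as the quotient of `P ⊗_k P`
by the corresponding balancing relations, and "Galois" means the lifted
canonical map is surjective with kernel exactly those relations.
-/

open TensorProduct LinearMap

noncomputable section

variable (k H K P : Type) [Field k] [Ring H] [HopfAlgebra k H]
  [Ring K] [HopfAlgebra k K] [Ring P] [Algebra k P]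

/-- `δ` is a (coassociative, counital) right `H`-comodule structure on `P`. -/
def IsRightComodule (δ : P →ₗ[k] P ⊗[k] H) : Prop :=
  (∀ p, (TensorProduct.rid k P) ((lTensor P Coalgebra.counit) (δ p)) = p) ∧
  (∀ p, (TensorProduct.assoc k P H H) ((rTensor H δ) (δ p))
      = (lTensor P Coalgebra.comul) (δ p))

/-- `δ` makes `P` a right `H`-comodule algebra. -/
def IsComodAlg (δ : P →ₗ[k] P ⊗[k] H) : Prop :=
  IsRightComodule k H P δ ∧ (∀ p q : P, δ (p * q) = δ p * δ q) ∧ δ 1 = 1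

/-- `δ` is a (coassociative, counital) left `K`-comodule structure on `P`. -/
def IsLeftComodule (δ : P →ₗ[k] K ⊗[k] P) : Prop :=
  (∀ p, (TensorProduct.lid k P) ((rTensor P Coalgebra.counit) (δ p)) = p) ∧
  (∀ p, (rTensor P Coalgebra.comul) (δ p)
      = (TensorProduct.assoc k K K P).symm ((lTensor K δ) (δ p)))

/-- `δ` makes `P` a left `K`-comodule algebra. -/
def IsLeftComodAlg (δ : P →ₗ[k] K ⊗[k] P) : Prop :=
  IsLeftComodule k K P δ ∧ (∀ p q : P, δ (p * q) = δ p * δ q) ∧ δ 1 = 1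

/-- The coinvariant subalgebra `B = P^{coH}` (as a subset). -/
def coinv (δ : P →ₗ[k] P ⊗[k] H) : Set P := {p | δ p = p ⊗ₜ[k] (1 : H)}

/-- Comultiplication iterated once: `x ↦ x₁ ⊗ (x₂ ⊗ x₃)`. -/
def comul₂ : K →ₗ[k] K ⊗[k] (K ⊗[k] K) :=
  (lTensor K Coalgebra.comul) ∘ₗ Coalgebra.comul

/-- Convolution product of two functionals on the coalgebra `K ⊗ K`. -/
def convKK (γ γ' : K ⊗[k] K →ₗ[k] k) : K ⊗[k] K →ₗ[k] k :=
  (TensorProduct.lid k k).toLinearMap ∘ₗ (TensorProduct.map γ γ') ∘ₗ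
    (Coalgebra.comul (R := k) (A := K ⊗[k] K))

/-- LHS of the 2-cocycle condition: `γ(x₁, y₁) γ(x₂ y₂, z)`. -/
def cocycleLHS (γ : K ⊗[k] K →ₗ[k] k) : (K ⊗[k] K) ⊗[k] K →ₗ[k] k :=
  (TensorProduct.lid k k).toLinearMap ∘ₗ
    (TensorProduct.map γ (γ ∘ₗ rTensor K (mul' k K))) ∘ₗ
    (TensorProduct.assoc k (K ⊗[k] K) (K ⊗[k] K) K).toLinearMap ∘ₗ
    (rTensor K (Coalgebra.comul (R := k) (A := K ⊗[k] K)))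

/-- RHS of the 2-cocycle condition: `γ(y₁, z₁) γ(x, y₂ z₂)`. -/
def cocycleRHS (γ : K ⊗[k] K →ₗ[k] k) : K ⊗[k] (K ⊗[k] K) →ₗ[k] k :=
  (TensorProduct.lid k k).toLinearMap ∘ₗ
    (TensorProduct.map γ (γ ∘ₗ lTensor K (mul' k K))) ∘ₗ
    (TensorProduct.leftComm k K (K ⊗[k] K) (K ⊗[k] K)).toLinearMap ∘ₗ
    (lTensor K (Coalgebra.comul (R := k) (A := K ⊗[k] K)))

/-- `γ` is a convolution-invertible 2-cocycle on `K` with inverse `γinv`. -/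
def IsTwoCocycle (γ γinv : K ⊗[k] K →ₗ[k] k) : Prop :=
  convKK k K γ γinv = Coalgebra.counit ∧
  convKK k K γinv γ = Coalgebra.counit ∧
  cocycleLHS k K γ
      = cocycleRHS k K γ ∘ₗ (TensorProduct.assoc k K K K).toLinearMap ∧
  (∀ x : K, γ ((1 : K) ⊗ₜ[k] x) = Coalgebra.counit x) ∧
  (∀ x : K, γ (x ⊗ₜ[k] (1 : K)) = Coalgebra.counit x)

/-- The twisted product on `P`: `p ⊗ q ↦ γ(p₍₋₁₎, q₍₋₁₎) p₍₀₎ q₍₀₎`. -/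
def twistedMulP (δK : P →ₗ[k] K ⊗[k] P) (γ : K ⊗[k] K →ₗ[k] k) :
    P ⊗[k] P →ₗ[k] P :=
  (TensorProduct.lid k P).toLinearMap ∘ₗ
    (TensorProduct.map γ (mul' k P)) ∘ₗ
    (TensorProduct.tensorTensorTensorComm k K P K P).toLinearMap ∘ₗ
    (TensorProduct.map δK δK)

/-- The canonical map of the extension `B ⊆ P`, lifted to `P ⊗_k P`. -/
def canMap (δ : P →ₗ[k] P ⊗[k] H) : P ⊗[k] P →ₗ[k] P ⊗[k] H :=
  (rTensor H (mul' k P)) ∘ₗ (TensorProduct.assoc k P P H).symm.toLinearMap ∘ₗ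
    (lTensor P δ)

/-- The `B`-balancing relations defining `P ⊗_B P` inside `P ⊗_k P`. -/
def galRel (δ : P →ₗ[k] P ⊗[k] H) : Submodule k (P ⊗[k] P) :=
  Submodule.span k {z | ∃ p q b, b ∈ coinv k H P δ ∧
    z = (p * b) ⊗ₜ[k] q - p ⊗ₜ[k] (b * q)}

/-- The canonical map of the twisted extension `_γB ⊆ _γP`. -/
def canMapTw (δ : P →ₗ[k] P ⊗[k] H) (δK : P →ₗ[k] K ⊗[k] P)
    (γ : K ⊗[k] K →ₗ[k] k) : P ⊗[k] P →ₗ[k] P ⊗[k] H :=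
  (rTensor H (twistedMulP k K P δK γ)) ∘ₗ
    (TensorProduct.assoc k P P H).symm.toLinearMap ∘ₗ (lTensor P δ)

/-- The `_γB`-balancing relations defining `_γP ⊗_{_γB} _γP`. -/
def galRelTw (δ : P →ₗ[k] P ⊗[k] H) (δK : P →ₗ[k] K ⊗[k] P)
    (γ : K ⊗[k] K →ₗ[k] k) : Submodule k (P ⊗[k] P) :=
  Submodule.span k {z | ∃ p q b, b ∈ coinv k H P δ ∧
    z = (twistedMulP k K P δK γ (p ⊗ₜ[k] b)) ⊗ₜ[k] q
      - p ⊗ₜ[k] (twistedMulP k K P δK γ (b ⊗ₜ[k] q))}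

section Comodule

open Coalgebra

variable {R C D M N L : Type} [Field R] [AddCommMonoid C] [Module R C]
  [AddCommMonoid D] [Module R D] [AddCommMonoid M] [Module R M]
  [AddCommMonoid N] [Module R N] [AddCommMonoid L] [Module R L]

/-- The endomorphism `m ↦ f(m₍₋₁₎) m₍₀₎` of a comodule given by a functional `f`. -/
def coact (ρ : M →ₗ[R] C ⊗[R] M) (f : C →ₗ[R] R) : M →ₗ[R] M :=
  (TensorProduct.lid R M).toLinearMap ∘ₗ rTensor M f ∘ₗ ρ

/-- The coaction of `C ⊗ D` on the tensor product of a `C`-comodule and a `D`-comodule. -/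
def tensorCoaction (ρ : M →ₗ[R] C ⊗[R] M) (σ : N →ₗ[R] D ⊗[R] N) :
    M ⊗[R] N →ₗ[R] (C ⊗[R] D) ⊗[R] (M ⊗[R] N) :=
  (TensorProduct.tensorTensorTensorComm R C M D N).toLinearMap ∘ₗ TensorProduct.map ρ σ

theorem tensorCoaction_tmul (ρ : M →ₗ[R] C ⊗[R] M) (σ : N →ₗ[R] D ⊗[R] N) (m : M) (n : N) :
    tensorCoaction ρ σ (m ⊗ₜ n) =
      TensorProduct.tensorTensorTensorComm R C M D N (ρ m ⊗ₜ σ n) := rfl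

theorem coact_apply (ρ : M →ₗ[R] C ⊗[R] M) (f : C →ₗ[R] R) (m : M) :
    coact ρ f m = TensorProduct.lid R M (rTensor M f (ρ m)) := rfl

theorem coact_tensor_tmul (ρ : M →ₗ[R] C ⊗[R] M) (σ : N →ₗ[R] D ⊗[R] N) (f : C →ₗ[R] R)
    (g : D →ₗ[R] R) (m : M) (n : N) :
    coact (tensorCoaction ρ σ) ((TensorProduct.lid R R).toLinearMap ∘ₗ TensorProduct.map f g)
      (m ⊗ₜ n) = coact ρ f m ⊗ₜ coact σ g n := by
  simp only [coact_apply, tensorCoaction_tmul]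
  generalize ρ m = u
  generalize σ n = v
  induction u with
  | zero => simp
  | add x y hx hy => simp only [map_add, TensorProduct.add_tmul, hx, hy]
  | tmul c m =>
    induction v with
    | zero => simp
    | add x y hx hy => simp only [map_add, TensorProduct.tmul_add, hx, hy]
    | tmul d n => simp [TensorProduct.smul_tmul', TensorProduct.tmul_smul, smul_smul, mul_comm]

/-- A map of comodules along a linear map of the coefficients intertwines `coact`. -/
theorem coact_comp_of_semiequivariant {ρ : M →ₗ[R] C ⊗[R] M} {σ : N →ₗ[R] D ⊗[R] N}
    {φ : C →ₗ[R] D} {ψ : M →ₗ[R] N} (h : σ ∘ₗ ψ = TensorProduct.map φ ψ ∘ₗ ρ) (f : D →ₗ[R] R)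
    (m : M) : coact σ f (ψ m) = ψ (coact ρ (f ∘ₗ φ) m) := by
  have h' : σ (ψ m) = TensorProduct.map φ ψ (ρ m) := LinearMap.congr_fun h m
  rw [coact_apply, coact_apply, h']
  generalize ρ m = u
  induction u with
  | zero => simp
  | add x y hx hy => simp only [map_add, hx, hy]
  | tmul c m => simp

theorem tensorCoaction_comp_map {C' D' M' N' : Type} [AddCommMonoid C'] [Module R C']
    [AddCommMonoid D'] [Module R D'] [AddCommMonoid M'] [Module R M'] [AddCommMonoid N']
    [Module R N'] {ρ : M →ₗ[R] C ⊗[R] M} {σ : N →ₗ[R] D ⊗[R] N}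
    {ρ' : M' →ₗ[R] C' ⊗[R] M'} {σ' : N' →ₗ[R] D' ⊗[R] N'}
    {φ : C →ₗ[R] C'} {ψ : M →ₗ[R] M'} {φ' : D →ₗ[R] D'} {ψ' : N →ₗ[R] N'}
    (h : ρ' ∘ₗ ψ = TensorProduct.map φ ψ ∘ₗ ρ) (h' : σ' ∘ₗ ψ' = TensorProduct.map φ' ψ' ∘ₗ σ) :
    tensorCoaction ρ' σ' ∘ₗ TensorProduct.map ψ ψ' =
      TensorProduct.map (TensorProduct.map φ φ') (TensorProduct.map ψ ψ') ∘ₗ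
        tensorCoaction ρ σ := by
  refine TensorProduct.ext' fun m n => ?_
  have e : ρ' (ψ m) = TensorProduct.map φ ψ (ρ m) := LinearMap.congr_fun h m
  have e' : σ' (ψ' n) = TensorProduct.map φ' ψ' (σ n) := LinearMap.congr_fun h' n
  simp only [LinearMap.comp_apply, TensorProduct.map_tmul, tensorCoaction_tmul, e, e']
  generalize ρ m = u
  generalize σ n = v
  induction u with
  | zero => simp
  | add x y hx hy => simp only [map_add, TensorProduct.add_tmul, hx, hy]
  | tmul c m =>
    induction v with
    | zero => simp
    | add x y hx hy => simp only [map_add, TensorProduct.tmul_add, hx, hy]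
    | tmul d n => simp

theorem tensorCoaction_assoc {E : Type} [AddCommMonoid E] [Module R E]
    (ρ : M →ₗ[R] C ⊗[R] M) (σ : N →ₗ[R] D ⊗[R] N) (τ : L →ₗ[R] E ⊗[R] L) :
    tensorCoaction ρ (tensorCoaction σ τ) ∘ₗ (TensorProduct.assoc R M N L).toLinearMap =
      TensorProduct.map (TensorProduct.assoc R C D E).toLinearMap
        (TensorProduct.assoc R M N L).toLinearMap ∘ₗ
        tensorCoaction (tensorCoaction ρ σ) τ := by
  refine TensorProduct.ext_threefold fun m n l => ?_
  simp only [LinearMap.comp_apply, LinearEquiv.coe_coe, TensorProduct.assoc_tmul,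
    tensorCoaction_tmul]
  generalize ρ m = u
  generalize σ n = v
  generalize τ l = w
  induction u with
  | zero => simp
  | add x y hx hy => simp only [map_add, TensorProduct.add_tmul, hx, hy]
  | tmul c m =>
    induction v with
    | zero => simp
    | add x y hx hy =>
      simp only [map_add, TensorProduct.tmul_add, TensorProduct.add_tmul, hx, hy]
    | tmul d n =>
      induction w with
      | zero => simp
      | add x y hx hy => simp only [map_add, TensorProduct.tmul_add, hx, hy]
      | tmul e l => simp

/-- If the ranges of `ι` and `ι'` are stable under the coactions, then so is the range of
`ι ⊗ ι'`. -/
theorem tensorCoaction_mem_range {ρ : M →ₗ[R] C ⊗[R] M} {σ : N →ₗ[R] D ⊗[R] N}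
    {U U' : Type} [AddCommMonoid U] [Module R U] [AddCommMonoid U'] [Module R U']
    {ι : U →ₗ[R] M} {ι' : U' →ₗ[R] N}
    (h : ∀ u, ρ (ι u) ∈ range (lTensor C ι)) (h' : ∀ u, σ (ι' u) ∈ range (lTensor D ι'))
    (t : U ⊗[R] U') :
    tensorCoaction ρ σ (TensorProduct.map ι ι' t) ∈
      range (lTensor (C ⊗[R] D) (TensorProduct.map ι ι')) := by
  induction t with
  | zero => simp
  | add x y hx hy => simp only [map_add]; exact add_mem hx hy
  | tmul u u' =>
    obtain ⟨a, ha⟩ := h u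
    obtain ⟨b, hb⟩ := h' u'
    rw [TensorProduct.map_tmul, tensorCoaction_tmul, ← ha, ← hb]
    clear ha hb
    refine ⟨TensorProduct.tensorTensorTensorComm R C U D U' (a ⊗ₜ b), ?_⟩
    induction a with
    | zero => simp
    | add x y hx hy => simp only [map_add, TensorProduct.add_tmul, hx, hy]
    | tmul c m =>
      induction b with
      | zero => simp
      | add x y hx hy => simp only [map_add, TensorProduct.tmul_add, hx, hy]
      | tmul d n => simp

theorem coact_mem_range {ρ : M →ₗ[R] C ⊗[R] M} {ι : N →ₗ[R] M}
    (h : ∀ u, ρ (ι u) ∈ range (lTensor C ι)) (f : C →ₗ[R] R) {m : M} (hm : m ∈ range ι) :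
    coact ρ f m ∈ range ι := by
  obtain ⟨u, rfl⟩ := hm
  obtain ⟨t, ht⟩ := h u
  rw [coact_apply, ← ht]
  clear ht
  refine ⟨TensorProduct.lid R N (rTensor N f t), ?_⟩
  induction t with
  | zero => simp
  | add x y hx hy => simp only [map_add, hx, hy]
  | tmul c n => simp

variable [Coalgebra R C] [Coalgebra R D]

/-- `ρ` is a coassociative, counital left coaction of the coalgebra `C` on `M`. -/
structure IsCoaction (ρ : M →ₗ[R] C ⊗[R] M) : Prop where
  counit (m : M) : TensorProduct.lid R M (rTensor M counit (ρ m)) = m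
  coassoc (m : M) :
    TensorProduct.assoc R C C M (rTensor M comul (ρ m)) = lTensor C ρ (ρ m)

/-- The convolution product of two functionals on a coalgebra. -/
def convFunctional (f g : C →ₗ[R] R) : C →ₗ[R] R :=
  (TensorProduct.lid R R).toLinearMap ∘ₗ TensorProduct.map f g ∘ₗ comul

theorem coact_counit {ρ : M →ₗ[R] C ⊗[R] M} (hρ : IsCoaction ρ) :
    coact ρ counit = LinearMap.id :=
  LinearMap.ext hρ.counit

theorem coact_coact {ρ : M →ₗ[R] C ⊗[R] M} (hρ : IsCoaction ρ) (f g : C →ₗ[R] R) (m : M) :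
    coact ρ f (coact ρ g m) = coact ρ (convFunctional g f) m := by
  have h₁ : ∀ t : C ⊗[R] M, coact ρ f (TensorProduct.lid R M (rTensor M g t)) =
      TensorProduct.lid R M (TensorProduct.map g
        ((TensorProduct.lid R M).toLinearMap ∘ₗ rTensor M f) (lTensor C ρ t)) := by
    intro t
    induction t with
    | zero => simp
    | add x y hx hy => simp only [map_add, hx, hy]
    | tmul x y => simp [coact_apply]
  have h₂ : ∀ t : (C ⊗[R] C) ⊗[R] M, TensorProduct.lid R M (TensorProduct.map g
        ((TensorProduct.lid R M).toLinearMap ∘ₗ rTensor M f) (TensorProduct.assoc R C C M t)) =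
      TensorProduct.lid R M (rTensor M
        ((TensorProduct.lid R R).toLinearMap ∘ₗ TensorProduct.map g f) t) := by
    intro t
    induction t with
    | zero => simp
    | add x y hx hy => simp only [map_add, hx, hy]
    | tmul x y =>
      induction x with
      | zero => simp
      | add x y hx hy => simp only [map_add, TensorProduct.add_tmul, hx, hy]
      | tmul x z => simp [smul_smul, mul_comm]
  rw [coact_apply ρ g, h₁, ← hρ.coassoc, h₂, coact_apply, convFunctional, ← LinearMap.comp_assoc,
    rTensor_comp_apply _ _ comul]

theorem IsCoaction.tensor {ρ : M →ₗ[R] C ⊗[R] M} {σ : N →ₗ[R] D ⊗[R] N}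
    (hρ : IsCoaction ρ) (hσ : IsCoaction σ) : IsCoaction (tensorCoaction ρ σ) where
  counit t := by
    induction t with
    | zero => simp
    | add x y hx hy => simp only [map_add, hx, hy]
    | tmul m n =>
      conv_rhs => rw [← hρ.counit m, ← hσ.counit n]
      rw [tensorCoaction_tmul]
      generalize ρ m = u
      generalize σ n = v
      induction u with
      | zero => simp
      | add x y hx hy => simp only [map_add, TensorProduct.add_tmul, hx, hy]
      | tmul c m =>
        induction v with
        | zero => simp
        | add x y hx hy => simp only [map_add, TensorProduct.tmul_add, hx, hy]
        | tmul d n => simp [TensorProduct.smul_tmul', TensorProduct.tmul_smul, smul_smul, mul_comm]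
  coassoc t := by
    induction t with
    | zero => simp
    | add x y hx hy => simp only [map_add, hx, hy]
    | tmul m n =>
      let F : (C ⊗[R] (C ⊗[R] M)) ⊗[R] (D ⊗[R] (D ⊗[R] N)) →ₗ[R]
          (C ⊗[R] D) ⊗[R] ((C ⊗[R] D) ⊗[R] (M ⊗[R] N)) :=
        lTensor (C ⊗[R] D) (TensorProduct.tensorTensorTensorComm R C M D N).toLinearMap ∘ₗ
          (TensorProduct.tensorTensorTensorComm R C (C ⊗[R] M) D (D ⊗[R] N)).toLinearMap
      have h₁ : ∀ u v, TensorProduct.assoc R (C ⊗[R] D) (C ⊗[R] D) (M ⊗[R] N)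
          (rTensor (M ⊗[R] N) comul (TensorProduct.tensorTensorTensorComm R C M D N (u ⊗ₜ v))) =
          F (TensorProduct.assoc R C C M (rTensor M comul u) ⊗ₜ
            TensorProduct.assoc R D D N (rTensor N comul v)) := by
        intro u v
        induction u with
        | zero => simp
        | add x y hx hy => simp only [map_add, TensorProduct.add_tmul, hx, hy]
        | tmul c m =>
          induction v with
          | zero => simp
          | add x y hx hy => simp only [map_add, TensorProduct.tmul_add, hx, hy]
          | tmul d n =>
            simp only [TensorProduct.tensorTensorTensorComm_tmul, rTensor_tmul,
              TensorProduct.comul_tmul]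
            generalize (comul c : C ⊗[R] C) = c'
            generalize (comul d : D ⊗[R] D) = d'
            induction c' with
            | zero => simp
            | add x y hx hy => simp only [map_add, TensorProduct.add_tmul, hx, hy]
            | tmul c c' =>
              induction d' with
              | zero => simp
              | add x y hx hy =>
                simp only [map_add, TensorProduct.tmul_add, TensorProduct.add_tmul, hx, hy]
              | tmul d d' => simp [F]
      have h₂ : ∀ u v, lTensor (C ⊗[R] D) (tensorCoaction ρ σ)
          (TensorProduct.tensorTensorTensorComm R C M D N (u ⊗ₜ v)) =
          F (lTensor C ρ u ⊗ₜ lTensor D σ v) := by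
        intro u v
        induction u with
        | zero => simp
        | add x y hx hy => simp only [map_add, TensorProduct.add_tmul, hx, hy]
        | tmul c m =>
          induction v with
          | zero => simp
          | add x y hx hy => simp only [map_add, TensorProduct.tmul_add, hx, hy]
          | tmul d n => simp [F, tensorCoaction_tmul]
      rw [tensorCoaction_tmul, h₁, h₂, hρ.coassoc, hσ.coassoc]

theorem convFunctional_comp (φ : C →ₗc[R] D) (f g : D →ₗ[R] R) :
    convFunctional (f ∘ₗ φ.toLinearMap) (g ∘ₗ φ.toLinearMap) =
      convFunctional f g ∘ₗ φ.toLinearMap := by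
  simp only [convFunctional, LinearMap.comp_assoc, ← φ.map_comp_comul, TensorProduct.map_comp]

theorem convFunctional_counit_right (f : C →ₗ[R] R) (g : C ⊗[R] D →ₗ[R] R) (c : C) (d : D) :
    convFunctional ((TensorProduct.lid R R).toLinearMap ∘ₗ TensorProduct.map f counit) g (c ⊗ₜ d) =
      TensorProduct.lid R R (TensorProduct.map f (g ∘ₗ (TensorProduct.mk R C D).flip d)
        (comul c)) := by
  have hd : TensorProduct.lid R D (rTensor D counit (comul d)) = d := by simp
  conv_rhs => rw [← hd]
  simp only [convFunctional, LinearMap.comp_apply, TensorProduct.comul_tmul]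
  generalize (comul c : C ⊗[R] C) = u
  generalize (comul d : D ⊗[R] D) = v
  induction u with
  | zero => simp
  | add x y hx hy => simp only [map_add, TensorProduct.add_tmul, hx, hy]
  | tmul c c' =>
    induction v with
    | zero => simp
    | add x y hx hy =>
      simp only [map_add, TensorProduct.tmul_add, hx, hy, TensorProduct.map_tmul,
        LinearMap.comp_add, LinearMap.add_apply, TensorProduct.tmul_add]
    | tmul d d' => simp [mul_assoc]

theorem convFunctional_counit_left (f : D →ₗ[R] R) (g : C ⊗[R] D →ₗ[R] R) (c : C) (d : D) :
    convFunctional ((TensorProduct.lid R R).toLinearMap ∘ₗ TensorProduct.map counit f) g (c ⊗ₜ d) =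
      TensorProduct.lid R R (TensorProduct.map f (g ∘ₗ TensorProduct.mk R C D c)
        (comul d)) := by
  have hc : TensorProduct.lid R C (rTensor C counit (comul c)) = c := by simp
  conv_rhs => rw [← hc]
  simp only [convFunctional, LinearMap.comp_apply, TensorProduct.comul_tmul]
  generalize (comul c : C ⊗[R] C) = u
  generalize (comul d : D ⊗[R] D) = v
  induction v with
  | zero => simp
  | add x y hx hy => simp only [map_add, TensorProduct.tmul_add, hx, hy]
  | tmul d d' =>
    induction u with
    | zero => simp
    | add x y hx hy =>
      simp only [map_add, TensorProduct.add_tmul, hx, hy, TensorProduct.map_tmul,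
        LinearMap.comp_add, LinearMap.add_apply, TensorProduct.tmul_add]
    | tmul c c' => simp [mul_assoc, mul_left_comm]

end Comodule

section Twist

variable {k H K P}

theorem IsLeftComodule.isCoaction {δK : P →ₗ[k] K ⊗[k] P} (h : IsLeftComodule k K P δK) :
    IsCoaction δK where
  counit := h.1
  coassoc p := by rw [h.2, LinearEquiv.apply_symm_apply]

theorem IsLeftComodAlg.coaction_comp_mul {δK : P →ₗ[k] K ⊗[k] P} (h : IsLeftComodAlg k K P δK) :
    δK ∘ₗ mul' k P = TensorProduct.map (mul' k K) (mul' k P) ∘ₗ tensorCoaction δK δK := by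
  refine TensorProduct.ext' fun p q => ?_
  simp only [LinearMap.comp_apply, mul'_apply, h.2.1, tensorCoaction_tmul]
  generalize δK p = u
  generalize δK q = v
  induction u with
  | zero => simp
  | add x y hx hy => simp only [map_add, TensorProduct.add_tmul, add_mul, hx, hy]
  | tmul x p =>
    induction v with
    | zero => simp
    | add x y hx hy => simp only [map_add, TensorProduct.tmul_add, mul_add, hx, hy]
    | tmul y q => simp

theorem twistedMulP_eq (δK : P →ₗ[k] K ⊗[k] P) (γ : K ⊗[k] K →ₗ[k] k) :
    twistedMulP k K P δK γ = mul' k P ∘ₗ coact (tensorCoaction δK δK) γ := by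
  refine LinearMap.ext fun t => ?_
  change TensorProduct.lid k P (TensorProduct.map γ (mul' k P) (tensorCoaction δK δK t)) =
    mul' k P (TensorProduct.lid k (P ⊗[k] P) (rTensor (P ⊗[k] P) γ (tensorCoaction δK δK t)))
  generalize tensorCoaction δK δK t = u
  induction u with
  | zero => simp
  | add x y hx hy => simp only [map_add, hx, hy]
  | tmul x p => simp

theorem cocycleLHS_eq (γ : K ⊗[k] K →ₗ[k] k) :
    cocycleLHS k K γ = convFunctional
      ((TensorProduct.lid k k).toLinearMap ∘ₗ TensorProduct.map γ Coalgebra.counit)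
      (γ ∘ₗ rTensor K (mul' k K)) := by
  refine TensorProduct.ext' fun c z => ?_
  rw [convFunctional_counit_right]
  simp only [cocycleLHS, LinearMap.comp_apply, LinearEquiv.coe_coe, rTensor_tmul]
  generalize (Coalgebra.comul c : (K ⊗[k] K) ⊗[k] (K ⊗[k] K)) = u
  induction u with
  | zero => simp
  | add x y hx hy => simp only [map_add, TensorProduct.add_tmul, hx, hy]
  | tmul x y => simp

theorem cocycleRHS_eq (γ : K ⊗[k] K →ₗ[k] k) :
    cocycleRHS k K γ = convFunctional
      ((TensorProduct.lid k k).toLinearMap ∘ₗ TensorProduct.map Coalgebra.counit γ)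
      (γ ∘ₗ lTensor K (mul' k K)) := by
  refine TensorProduct.ext' fun x c => ?_
  rw [convFunctional_counit_left]
  simp only [cocycleRHS, LinearMap.comp_apply, LinearEquiv.coe_coe, lTensor_tmul]
  generalize (Coalgebra.comul c : (K ⊗[k] K) ⊗[k] (K ⊗[k] K)) = u
  induction u with
  | zero => simp
  | add x y hx hy => simp only [map_add, TensorProduct.tmul_add, hx, hy]
  | tmul y z => simp

theorem coact_twistedMulP_rTensor {δK : P →ₗ[k] K ⊗[k] P} (hδK : IsLeftComodAlg k K P δK)
    (γ : K ⊗[k] K →ₗ[k] k) (t : (P ⊗[k] P) ⊗[k] P) :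
    coact (tensorCoaction δK δK) γ (rTensor P (twistedMulP k K P δK γ) t) =
      rTensor P (mul' k P)
        (coact (tensorCoaction (tensorCoaction δK δK) δK) (cocycleLHS k K γ) t) := by
  have hc := hδK.1.isCoaction
  have h₁ : rTensor P (coact (tensorCoaction δK δK) γ) = coact
      (tensorCoaction (tensorCoaction δK δK) δK)
      ((TensorProduct.lid k k).toLinearMap ∘ₗ TensorProduct.map γ Coalgebra.counit) := by
    refine TensorProduct.ext' fun u q => ?_
    rw [coact_tensor_tmul, coact_counit hc]
    rfl
  have h₂ := tensorCoaction_comp_map hδK.coaction_comp_mul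
    (show δK ∘ₗ LinearMap.id = TensorProduct.map LinearMap.id LinearMap.id ∘ₗ δK by simp)
  rw [cocycleLHS_eq, ← coact_coact ((hc.tensor hc).tensor hc), twistedMulP_eq,
    rTensor_comp_apply, h₁]
  exact coact_comp_of_semiequivariant h₂ γ _

theorem coact_twistedMulP_lTensor {δK : P →ₗ[k] K ⊗[k] P} (hδK : IsLeftComodAlg k K P δK)
    (γ : K ⊗[k] K →ₗ[k] k) (t : P ⊗[k] (P ⊗[k] P)) :
    coact (tensorCoaction δK δK) γ (lTensor P (twistedMulP k K P δK γ) t) =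
      lTensor P (mul' k P)
        (coact (tensorCoaction δK (tensorCoaction δK δK)) (cocycleRHS k K γ) t) := by
  have hc := hδK.1.isCoaction
  have h₁ : lTensor P (coact (tensorCoaction δK δK) γ) = coact
      (tensorCoaction δK (tensorCoaction δK δK))
      ((TensorProduct.lid k k).toLinearMap ∘ₗ TensorProduct.map Coalgebra.counit γ) := by
    refine TensorProduct.ext' fun u q => ?_
    rw [coact_tensor_tmul, coact_counit hc]
    rfl
  have h₂ := tensorCoaction_comp_map
    (show δK ∘ₗ LinearMap.id = TensorProduct.map LinearMap.id LinearMap.id ∘ₗ δK by simp)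
    hδK.coaction_comp_mul
  rw [cocycleRHS_eq, ← coact_coact (hc.tensor (hc.tensor hc)), twistedMulP_eq,
    lTensor_comp_apply, h₁]
  exact coact_comp_of_semiequivariant h₂ γ _

/-- The map `(p ⊗ b) ⊗ q ↦ m(p ⊗ b) ⊗ q - p ⊗ m(b ⊗ q)` for a multiplication `m`. -/
def balancing (m : P ⊗[k] P →ₗ[k] P) : (P ⊗[k] P) ⊗[k] P →ₗ[k] P ⊗[k] P :=
  rTensor P m - lTensor P m ∘ₗ (TensorProduct.assoc k P P P).toLinearMap

theorem coact_balancing {δK : P →ₗ[k] K ⊗[k] P} (hδK : IsLeftComodAlg k K P δK)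
    {γ : K ⊗[k] K →ₗ[k] k}
    (hγ : cocycleLHS k K γ = cocycleRHS k K γ ∘ₗ (TensorProduct.assoc k K K K).toLinearMap)
    (t : (P ⊗[k] P) ⊗[k] P) :
    coact (tensorCoaction δK δK) γ (balancing (twistedMulP k K P δK γ) t) =
      balancing (mul' k P)
        (coact (tensorCoaction (tensorCoaction δK δK) δK) (cocycleLHS k K γ) t) := by
  simp only [balancing, LinearMap.sub_apply, map_sub, LinearMap.comp_apply, LinearEquiv.coe_coe]
  rw [coact_twistedMulP_rTensor hδK, coact_twistedMulP_lTensor hδK]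
  congr 2
  have h := coact_comp_of_semiequivariant (tensorCoaction_assoc δK δK δK) (cocycleRHS k K γ) t
  rwa [← hγ] at h

/-- The coinvariants as a linear subspace. -/
def coinvSubmodule (δ : P →ₗ[k] P ⊗[k] H) : Submodule k P :=
  ker (δ - (TensorProduct.mk k P H).flip 1)

theorem mem_coinvSubmodule {δ : P →ₗ[k] P ⊗[k] H} {p : P} :
    p ∈ coinvSubmodule δ ↔ p ∈ coinv k H P δ := by
  simp [coinvSubmodule, coinv, sub_eq_zero]

/-- The inclusion `P ⊗ B ⊗ P → P ⊗ P ⊗ P`, where `B` is the space of coinvariants. -/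
def coinvIncl (δ : P →ₗ[k] P ⊗[k] H) :
    (P ⊗[k] coinvSubmodule δ) ⊗[k] P →ₗ[k] (P ⊗[k] P) ⊗[k] P :=
  TensorProduct.map (TensorProduct.map LinearMap.id (coinvSubmodule δ).subtype) LinearMap.id

theorem span_balancing (δ : P →ₗ[k] P ⊗[k] H) (m : P ⊗[k] P →ₗ[k] P) :
    Submodule.span k {z | ∃ p q b, b ∈ coinv k H P δ ∧
      z = m (p ⊗ₜ[k] b) ⊗ₜ[k] q - p ⊗ₜ[k] m (b ⊗ₜ[k] q)} =
      (range (coinvIncl δ)).map (balancing m) := by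
  apply le_antisymm
  · rw [Submodule.span_le]
    rintro _ ⟨p, q, b, hb, rfl⟩
    exact ⟨(p ⊗ₜ b) ⊗ₜ q, ⟨(p ⊗ₜ ⟨b, mem_coinvSubmodule.2 hb⟩) ⊗ₜ q, rfl⟩, rfl⟩
  · rintro _ ⟨_, ⟨t, rfl⟩, rfl⟩
    induction t with
    | zero => simp
    | add x y hx hy => simp only [map_add]; exact add_mem hx hy
    | tmul u q =>
      induction u with
      | zero => simp
      | add x y hx hy => simp only [TensorProduct.add_tmul, map_add]; exact add_mem hx hy
      | tmul p b => exact Submodule.subset_span ⟨p, q, b, mem_coinvSubmodule.1 b.2, rfl⟩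

/-- The coinvariants form a subcomodule for a commuting coaction. -/
theorem coaction_coinv_mem_range {δ : P →ₗ[k] P ⊗[k] H} {δK : P →ₗ[k] K ⊗[k] P}
    (hcomm : ∀ p : P, (lTensor K δ) (δK p)
        = (TensorProduct.assoc k K P H) ((rTensor H δK) (δ p)))
    (b : coinvSubmodule δ) :
    δK ((coinvSubmodule δ).subtype b) ∈ range (lTensor K (coinvSubmodule δ).subtype) := by
  have hex : Function.Exact (coinvSubmodule δ).subtype (δ - (TensorProduct.mk k P H).flip 1) :=
    LinearMap.exact_subtype_ker_map _
  refine (Module.Flat.lTensor_exact K hex _).1 ?_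
  have hb : δ b = (b : P) ⊗ₜ[k] (1 : H) := mem_coinvSubmodule.1 b.2
  rw [lTensor_sub, LinearMap.sub_apply, sub_eq_zero, Submodule.subtype_apply, hcomm, hb,
    rTensor_tmul]
  generalize δK b = u
  induction u with
  | zero => simp
  | add x y hx hy => simp only [map_add, TensorProduct.add_tmul, hx, hy]
  | tmul x p => simp

theorem coact_mem_range_coinvIncl {δ : P →ₗ[k] P ⊗[k] H} {δK : P →ₗ[k] K ⊗[k] P}
    (hcomm : ∀ p : P, (lTensor K δ) (δK p)
        = (TensorProduct.assoc k K P H) ((rTensor H δK) (δ p)))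
    (f : (K ⊗[k] K) ⊗[k] K →ₗ[k] k) {t : (P ⊗[k] P) ⊗[k] P} (ht : t ∈ range (coinvIncl δ)) :
    coact (tensorCoaction (tensorCoaction δK δK) δK) f t ∈ range (coinvIncl δ) := by
  have hid : ∀ p : P, δK (LinearMap.id (R := k) p) ∈ range (lTensor K (LinearMap.id (R := k))) := by
    intro p
    rw [lTensor_id, range_id]
    exact Submodule.mem_top
  have h₂ : ∀ u, tensorCoaction δK δK (TensorProduct.map LinearMap.id
      (coinvSubmodule δ).subtype u) ∈ _ := tensorCoaction_mem_range hid (coaction_coinv_mem_range hcomm)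
  have h₃ : ∀ u, tensorCoaction (tensorCoaction δK δK) δK (coinvIncl δ u) ∈
      range (lTensor ((K ⊗[k] K) ⊗[k] K) (coinvIncl δ)) :=
    tensorCoaction_mem_range h₂ hid
  exact coact_mem_range h₃ f ht

theorem canMapTw_eq {δ : P →ₗ[k] P ⊗[k] H} {δK : P →ₗ[k] K ⊗[k] P}
    (hcomm : ∀ p : P, (lTensor K δ) (δK p)
        = (TensorProduct.assoc k K P H) ((rTensor H δK) (δ p)))
    (γ : K ⊗[k] K →ₗ[k] k) :
    canMapTw k H K P δ δK γ = canMap k H P δ ∘ₗ coact (tensorCoaction δK δK) γ := by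
  let A : (K ⊗[k] P) ⊗[k] (K ⊗[k] (P ⊗[k] H)) →ₗ[k] (P ⊗[k] P) ⊗[k] H :=
    (TensorProduct.assoc k P P H).symm.toLinearMap ∘ₗ
      (TensorProduct.lid k (P ⊗[k] (P ⊗[k] H))).toLinearMap ∘ₗ
      rTensor (P ⊗[k] (P ⊗[k] H)) γ ∘ₗ
      (TensorProduct.tensorTensorTensorComm k K P K (P ⊗[k] H)).toLinearMap
  have h₁ : ∀ (p : P) (s : P ⊗[k] H), rTensor H (coact (tensorCoaction δK δK) γ)
      ((TensorProduct.assoc k P P H).symm (p ⊗ₜ s)) =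
      A (δK p ⊗ₜ TensorProduct.assoc k K P H (rTensor H δK s)) := by
    intro p s
    induction s with
    | zero => simp
    | add x y hx hy => simp only [map_add, TensorProduct.tmul_add, hx, hy]
    | tmul q h =>
      simp only [TensorProduct.assoc_symm_tmul, rTensor_tmul, coact_apply, tensorCoaction_tmul]
      generalize δK p = u
      generalize δK q = v
      induction u with
      | zero => simp
      | add x y hx hy => simp only [map_add, TensorProduct.add_tmul, hx, hy]
      | tmul x p =>
        induction v with
        | zero => simp
        | add x y hx hy =>
          simp only [map_add, TensorProduct.tmul_add, TensorProduct.add_tmul, hx, hy]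
        | tmul y q => simp [A, TensorProduct.smul_tmul']
  have h₂ : ∀ p q : P, (TensorProduct.assoc k P P H).symm
      (lTensor P δ (coact (tensorCoaction δK δK) γ (p ⊗ₜ q))) =
      A (δK p ⊗ₜ lTensor K δ (δK q)) := by
    intro p q
    rw [coact_apply, tensorCoaction_tmul]
    generalize δK p = u
    generalize δK q = v
    induction u with
    | zero => simp
    | add x y hx hy => simp only [map_add, TensorProduct.add_tmul, hx, hy]
    | tmul x p =>
      induction v with
      | zero => simp
      | add x y hx hy => simp only [map_add, TensorProduct.tmul_add, hx, hy]
      | tmul y q => simp [A]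
  refine TensorProduct.ext' fun p q => ?_
  simp only [canMapTw, canMap, twistedMulP_eq, LinearMap.comp_apply, LinearEquiv.coe_coe,
    lTensor_tmul, rTensor_comp_apply, h₁, h₂, hcomm]

theorem coact_coact_of_conv {δK : P →ₗ[k] K ⊗[k] P} (hδK : IsLeftComodAlg k K P δK)
    {γ γ' : K ⊗[k] K →ₗ[k] k} (h : convKK k K γ γ' = Coalgebra.counit) (t : P ⊗[k] P) :
    coact (tensorCoaction δK δK) γ' (coact (tensorCoaction δK δK) γ t) = t := by
  have hc := hδK.1.isCoaction
  rw [coact_coact (hc.tensor hc), show convFunctional γ γ' = Coalgebra.counit from h,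
    coact_counit (hc.tensor hc), LinearMap.id_apply]

/-- The action of the cocycle on `P ⊗ P ⊗ P` has a right inverse of the same shape. -/
theorem exists_coact_cocycleLHS_eq {δK : P →ₗ[k] K ⊗[k] P} (hδK : IsLeftComodAlg k K P δK)
    {γ γ' : K ⊗[k] K →ₗ[k] k} (h : convKK k K γ' γ = Coalgebra.counit) :
    ∃ f, ∀ t : (P ⊗[k] P) ⊗[k] P,
      coact (tensorCoaction (tensorCoaction δK δK) δK) (cocycleLHS k K γ)
        (coact (tensorCoaction (tensorCoaction δK δK) δK) f t) = t := by
  have hc := hδK.1.isCoaction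
  have hc₂ := hc.tensor hc
  have hc₃ := hc₂.tensor hc
  refine ⟨convFunctional (γ' ∘ₗ rTensor K (mul' k K))
    ((TensorProduct.lid k k).toLinearMap ∘ₗ TensorProduct.map γ' Coalgebra.counit), fun t => ?_⟩
  have h₁ : ∀ t : (P ⊗[k] P) ⊗[k] P, coact (tensorCoaction (tensorCoaction δK δK) δK)
      ((TensorProduct.lid k k).toLinearMap ∘ₗ TensorProduct.map γ Coalgebra.counit)
      (coact (tensorCoaction (tensorCoaction δK δK) δK)
        ((TensorProduct.lid k k).toLinearMap ∘ₗ TensorProduct.map γ' Coalgebra.counit) t) = t := by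
    intro t
    induction t with
    | zero => simp
    | add x y hx hy => simp only [map_add, hx, hy]
    | tmul u q =>
      rw [coact_tensor_tmul, coact_tensor_tmul, coact_coact_of_conv hδK h, coact_counit hc]
      rfl
  have h₂ : convFunctional (γ' ∘ₗ rTensor K (mul' k K)) (γ ∘ₗ rTensor K (mul' k K)) =
      Coalgebra.counit := by
    let φ := CoalgHom.rTensor K (Bialgebra.mulCoalgHom k K)
    refine (convFunctional_comp φ γ' γ).trans ?_
    rw [show convFunctional γ' γ = Coalgebra.counit from h]
    exact φ.counit_comp
  rw [cocycleLHS_eq, ← coact_coact hc₃, ← coact_coact hc₃, h₁, coact_coact hc₃, h₂,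
    coact_counit hc₃, LinearMap.id_apply]

end Twist

theorem twisted_Galois_extension
    (δ : P →ₗ[k] P ⊗[k] H) (hδ : IsComodAlg k H P δ)
    (δK : P →ₗ[k] K ⊗[k] P) (hδK : IsLeftComodAlg k K P δK)
    (hcomm : ∀ p : P, (lTensor K δ) (δK p)
        = (TensorProduct.assoc k K P H) ((rTensor H δK) (δ p)))
    (γ γinv : K ⊗[k] K →ₗ[k] k) (hγ : IsTwoCocycle k K γ γinv)
    (hsurj : Function.Surjective (canMap k H P δ))
    (hker : ker (canMap k H P δ) = galRel k H P δ) :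
    Function.Surjective (canMapTw k H K P δ δK γ) ∧
    ker (canMapTw k H K P δ δK γ) = galRelTw k H K P δ δK γ := by
  obtain ⟨hright, hleft, hcocycle, -, -⟩ := hγ
  have hinj : Function.Injective (coact (tensorCoaction δK δK) γ) :=
    Function.LeftInverse.injective (coact_coact_of_conv hδK hright)
  have hsurj' : Function.Surjective (coact (tensorCoaction δK δK) γ) :=
    Function.RightInverse.surjective (coact_coact_of_conv hδK hleft)
  have hrel : galRel k H P δ = (range (coinvIncl δ)).map (balancing (mul' k P)) :=
    span_balancing δ (mul' k P)
  have hrelTw : galRelTw k H K P δ δK γ =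
      (range (coinvIncl δ)).map (balancing (twistedMulP k K P δK γ)) :=
    span_balancing δ (twistedMulP k K P δK γ)
  have hmap : (galRelTw k H K P δ δK γ).map (coact (tensorCoaction δK δK) γ) =
      galRel k H P δ := by
    rw [hrel, hrelTw]
    apply le_antisymm
    · rintro _ ⟨_, ⟨t, ht, rfl⟩, rfl⟩
      rw [coact_balancing hδK hcocycle]
      exact ⟨_, coact_mem_range_coinvIncl hcomm _ ht, rfl⟩
    · rintro _ ⟨t, ht, rfl⟩
      obtain ⟨f, hf⟩ := exists_coact_cocycleLHS_eq hδK hleft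
      refine ⟨_, ⟨_, coact_mem_range_coinvIncl hcomm f ht, rfl⟩, ?_⟩
      rw [coact_balancing hδK hcocycle, hf]
  rw [canMapTw_eq hcomm]
  refine ⟨hsurj.comp hsurj', ?_⟩
  rw [ker_comp, hker, ← hmap, Submodule.comap_map_eq_of_injective hinj]

end
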